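/- Let m ≥ 2 and let P^B be the NBCRW transition matrix on the rose graph R_m^4: from the hub, probability 1/(2m) to each internal node; from each internal node, probability m/(m + √(2m−1)) to the hub and √(2m−1)/(m + √(2m−1)) to its peripheral neighbor; from each peripheral node, probability 1/2 to each of its two internal neighbors. Suppose h : {0,1,…,3m} → ℝ satisfies h(0) = 0 and h(i) = 1 + Σ_j P^B(i,j)·h(j) for every vertex i ≠ 0. Then h(i) = 1 + 2√(2m−1)/m for every internal node i, h(j) = 2 + 2√(2m−1)/m for every peripheral node j, and the partial mean hitting time to the hub equals T_H^B = (1/(3m))·Σ_{i≠0} h(i) = 4/3 + 2√(2m−1)/m. -/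

import Mathlib

open Finset
/-- Transition matrix of the non-backtracking centrality based random walk (NBCRW) on the
rose graph `R_m^4`: from the hub (vertex `0`) probability `1/(2m)` to each internal node;
from each internal node probability `m/(m+√(2m-1))` to the hub and `√(2m-1)/(m+√(2m-1))`
to its peripheral neighbor; from each peripheral node probability `1/2` to each of its
two internal neighbors. -/
noncomputable def rosePB (m : ℕ) : Matrix (Fin (3 * m + 1)) (Fin (3 * m + 1)) ℝ :=
  fun i j =>
    if (i : ℕ) = 0 ∧ (j : ℕ) % 3 ≠ 0 then 1 / (2 * (m : ℝ))
    else if (i : ℕ) % 3 ≠ 0 ∧ (j : ℕ) = 0 then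
      (m : ℝ) / ((m : ℝ) + Real.sqrt (2 * (m : ℝ) - 1))
    else if ((i : ℕ) % 3 = 1 ∧ (j : ℕ) = (i : ℕ) + 2)
        ∨ ((i : ℕ) % 3 = 2 ∧ (j : ℕ) = (i : ℕ) + 1) then
      Real.sqrt (2 * (m : ℝ) - 1) / ((m : ℝ) + Real.sqrt (2 * (m : ℝ) - 1))
    else if (i : ℕ) % 3 = 0 ∧ (i : ℕ) ≠ 0
        ∧ ((j : ℕ) + 2 = (i : ℕ) ∨ (j : ℕ) + 1 = (i : ℕ)) then 1 / 2
    else 0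

theorem rosePB_sum_internal {m : ℕ} (h : Fin (3 * m + 1) → ℝ) (h0 : h 0 = 0)
    {i j : Fin (3 * m + 1)}
    (hij : ((i : ℕ) % 3 = 1 ∧ (j : ℕ) = (i : ℕ) + 2)
      ∨ ((i : ℕ) % 3 = 2 ∧ (j : ℕ) = (i : ℕ) + 1)) :
    ∑ k, rosePB m i k * h k
      = Real.sqrt (2 * (m : ℝ) - 1) / ((m : ℝ) + Real.sqrt (2 * (m : ℝ) - 1)) * h j := by
  rw [Fintype.sum_eq_single j]
  · congr 1
    unfold rosePB
    rw [if_neg (by omega), if_neg (by omega), if_pos hij]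
  · intro k hk
    by_cases hk0 : k = 0
    · rw [hk0, h0, mul_zero]
    · rw [Ne, Fin.ext_iff] at hk
      rw [Fin.ext_iff, Fin.val_zero] at hk0
      unfold rosePB
      rw [if_neg (by omega), if_neg (by omega), if_neg (by omega), if_neg (by omega), zero_mul]

theorem rosePB_sum_peripheral {m : ℕ} (h : Fin (3 * m + 1) → ℝ)
    {i j k : Fin (3 * m + 1)} (hi : (i : ℕ) % 3 = 0)
    (hj : (j : ℕ) + 2 = (i : ℕ)) (hk : (k : ℕ) + 1 = (i : ℕ)) :
    ∑ l, rosePB m i l * h l = 1 / 2 * h j + 1 / 2 * h k := by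
  rw [Fintype.sum_eq_add j k (by rw [Ne, Fin.ext_iff]; omega)]
  · unfold rosePB
    rw [if_neg (by omega), if_neg (by omega), if_neg (by omega), if_pos (by omega),
      if_neg (by omega), if_neg (by omega), if_neg (by omega), if_pos (by omega)]
  · rintro l ⟨hlj, hlk⟩
    rw [Ne, Fin.ext_iff] at hlj hlk
    unfold rosePB
    rw [if_neg (by omega), if_neg (by omega), if_neg (by omega), if_neg (by omega), zero_mul]

theorem rose_petal_hitting {m : ℕ} (hm : 0 < m) (h : Fin (3 * m + 1) → ℝ) (h0 : h 0 = 0)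
    (hstep : ∀ i : Fin (3 * m + 1), i ≠ 0 → h i = 1 + ∑ j, rosePB m i j * h j)
    {i j k : Fin (3 * m + 1)} (hk : (k : ℕ) % 3 = 0)
    (hi : (i : ℕ) + 2 = (k : ℕ)) (hj : (j : ℕ) + 1 = (k : ℕ)) :
    h i = 1 + 2 * Real.sqrt (2 * (m : ℝ) - 1) / (m : ℝ) ∧
      h j = 1 + 2 * Real.sqrt (2 * (m : ℝ) - 1) / (m : ℝ) ∧
      h k = 2 + 2 * Real.sqrt (2 * (m : ℝ) - 1) / (m : ℝ) := by
  have ei := hstep i (by rw [Ne, Fin.ext_iff, Fin.val_zero]; omega)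
  have ej := hstep j (by rw [Ne, Fin.ext_iff, Fin.val_zero]; omega)
  have ek := hstep k (by rw [Ne, Fin.ext_iff, Fin.val_zero]; omega)
  rw [rosePB_sum_internal h h0 (j := k) (by omega)] at ei ej
  rw [rosePB_sum_peripheral h hk hi hj] at ek
  have hmR : (0 : ℝ) < m := by exact_mod_cast hm
  have hs := Real.sqrt_nonneg (2 * (m : ℝ) - 1)
  set s := Real.sqrt (2 * (m : ℝ) - 1)
  have hms : (m : ℝ) + s ≠ 0 := by positivity
  have hk' : h k = 2 + 2 * s / m := by
    rw [ei, ej] at ek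
    field_simp at ek ⊢
    linarith
  refine ⟨?_, ?_, hk'⟩
  · rw [ei, hk']; field_simp
  · rw [ej, hk']; field_simp

theorem sum_range_petals (m : ℕ) (a b : ℝ) :
    ∑ n ∈ Finset.range (3 * m + 1), (if n = 0 then 0 else if n % 3 = 0 then b else a)
      = m * (2 * a + b) := by
  induction m with
  | zero => simp
  | succ m ih =>
    rw [show 3 * (m + 1) + 1 = 3 * m + 1 + 1 + 1 + 1 by ring, Finset.sum_range_succ,
      Finset.sum_range_succ, Finset.sum_range_succ, ih,
      if_neg (by omega), if_neg (by omega), if_neg (by omega), if_neg (by omega),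
      if_neg (by omega), if_pos (by omega)]
    push_cast
    ring

/-- Mean hitting time to the hub for the NBCRW on the rose graph `R_m^4`: the solution of
the first-step equations equals `1 + 2√(2m-1)/m` at every internal node and
`2 + 2√(2m-1)/m` at every peripheral node, and the partial mean hitting time to the hub
is `4/3 + 2√(2m-1)/m`. -/
theorem rose_nbcrw_hitting_hub (m : ℕ) (hm : 2 ≤ m)
    (h : Fin (3 * m + 1) → ℝ)
    (h0 : h 0 = 0)
    (hstep : ∀ i : Fin (3 * m + 1), i ≠ 0 → h i = 1 + ∑ j, rosePB m i j * h j) :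
    (∀ i : Fin (3 * m + 1), (i : ℕ) % 3 ≠ 0 →
        h i = 1 + 2 * Real.sqrt (2 * (m : ℝ) - 1) / (m : ℝ)) ∧
      (∀ i : Fin (3 * m + 1), (i : ℕ) % 3 = 0 → (i : ℕ) ≠ 0 →
        h i = 2 + 2 * Real.sqrt (2 * (m : ℝ) - 1) / (m : ℝ)) ∧
      (1 / (3 * (m : ℝ)))
          * ∑ i ∈ Finset.univ.filter (fun i : Fin (3 * m + 1) => i ≠ 0), h i
        = 4 / 3 + 2 * Real.sqrt (2 * (m : ℝ) - 1) / (m : ℝ) := by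
  have hint : ∀ i : Fin (3 * m + 1), (i : ℕ) % 3 ≠ 0 →
      h i = 1 + 2 * Real.sqrt (2 * (m : ℝ) - 1) / (m : ℝ) := by
    intro i hi
    have hlt := i.isLt
    rcases (by omega : (i : ℕ) % 3 = 1 ∨ (i : ℕ) % 3 = 2) with h1 | h2
    · exact (rose_petal_hitting (by omega) h h0 hstep (i := i)
        (j := ⟨i + 1, by omega⟩) (k := ⟨i + 2, by omega⟩)
        (by simp only; omega) rfl rfl).1
    · exact (rose_petal_hitting (by omega) h h0 hstep (i := ⟨i - 1, by omega⟩)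
        (j := i) (k := ⟨i + 1, by omega⟩)
        (by simp only; omega) (by simp only; omega) rfl).2.1
  have hper : ∀ i : Fin (3 * m + 1), (i : ℕ) % 3 = 0 → (i : ℕ) ≠ 0 →
      h i = 2 + 2 * Real.sqrt (2 * (m : ℝ) - 1) / (m : ℝ) := by
    intro i hi hi0
    have hlt := i.isLt
    exact (rose_petal_hitting (by omega) h h0 hstep (i := ⟨i - 2, by omega⟩)
      (j := ⟨i - 1, by omega⟩) (k := i)
      hi (by simp only; omega) (by simp only; omega)).2.2
  refine ⟨hint, hper, ?_⟩
  have hsum : ∑ i ∈ Finset.univ.filter (fun i : Fin (3 * m + 1) => i ≠ 0), h i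
      = m * (2 * (1 + 2 * Real.sqrt (2 * (m : ℝ) - 1) / (m : ℝ))
        + (2 + 2 * Real.sqrt (2 * (m : ℝ) - 1) / (m : ℝ))) := by
    rw [← sum_range_petals, ← Fin.sum_univ_eq_sum_range
      (fun n => if n = 0 then (0 : ℝ) else if n % 3 = 0
        then 2 + 2 * Real.sqrt (2 * (m : ℝ) - 1) / (m : ℝ)
        else 1 + 2 * Real.sqrt (2 * (m : ℝ) - 1) / (m : ℝ)), Finset.sum_filter]
    refine Finset.sum_congr rfl fun i _ => ?_
    by_cases hi0 : i = 0
    · simp [hi0]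
    · have hi0' : (i : ℕ) ≠ 0 := by rwa [Fin.ext_iff, Fin.val_zero] at hi0
      rw [if_pos hi0, if_neg hi0']
      split_ifs with hi
      · exact hper i hi hi0'
      · exact hint i hi
  have hmR : (m : ℝ) ≠ 0 := by norm_cast; omega
  rw [hsum]
  field_simp
  ring
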